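/- Pointwise gradient decay of the discrete heat kernel on ℤ: there exists a constant C > 0 such that for all c > 0, all t > 0 and all ℓ ∈ ℤ, |p̄_t(ℓ+1) - p̄_t(ℓ)| ≤ C·min(1, 1/(ct)). -/

import Mathlib

/-- `n`-step simple random walk distribution on `ℤ`:
`q_n(ℓ) = 2^{-n}·binom(n,(n+ℓ)/2)` if `n+ℓ` is even and `|ℓ| ≤ n`, and `0` otherwise. -/
noncomputable def rwStep (n : ℕ) (l : ℤ) : ℝ :=
  if ((n : ℤ) + l) % 2 = 0 ∧ |l| ≤ (n : ℤ) then
    ((1 : ℝ) / 2) ^ n * (Nat.choose n (((n : ℤ) + l) / 2).toNat : ℝ)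
  else 0

/-- The discrete heat kernel on `ℤ` sped up by `2c`:
`p̄_t(ℓ) = e^{-2ct} Σ_{n≥0} ((2ct)^n/n!) q_n(ℓ)`. -/
noncomputable def heatKernelZ (c t : ℝ) (l : ℤ) : ℝ :=
  Real.exp (-(2 * c * t)) * ∑' n : ℕ, (2 * c * t) ^ n / (Nat.factorial n : ℝ) * rwStep n l

theorem rwStep_two_mul_sub (n k : ℕ) :
    rwStep n (2 * (k : ℤ) - n) = ((1 : ℝ) / 2) ^ n * (Nat.choose n k : ℝ) := by
  have e : ((n : ℤ) + (2 * (k : ℤ) - n)) / 2 = k := by omega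
  unfold rwStep
  rw [e]
  split_ifs with h
  · simp
  · have hk : n < k := by
      by_contra hk
      exact h ⟨by omega, abs_le.mpr ⟨by omega, by omega⟩⟩
    simp [Nat.choose_eq_zero_of_lt hk]

theorem rwStep_eq_zero_of_odd {n : ℕ} {l : ℤ} (h : ((n : ℤ) + l) % 2 ≠ 0) : rwStep n l = 0 :=
  if_neg fun H => h H.1

theorem rwStep_eq_zero_of_lt {n : ℕ} {l : ℤ} (h : l < -(n : ℤ)) : rwStep n l = 0 :=
  if_neg fun H => by
    have := (abs_le.mp H.2).1
    omega

theorem rwStep_zero (l : ℤ) : rwStep 0 l = if l = 0 then 1 else 0 := by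
  by_cases hl : l = 0
  · simp [rwStep, hl]
  · simp [rwStep, hl]

theorem rwStep_succ (n : ℕ) (l : ℤ) :
    rwStep (n + 1) l = (rwStep n (l - 1) + rwStep n (l + 1)) / 2 := by
  by_cases hp : ((n : ℤ) + 1 + l) % 2 = 0
  · obtain ⟨m, hm⟩ : ∃ m : ℤ, l = 2 * m - n - 1 := ⟨((n : ℤ) + 1 + l) / 2, by omega⟩
    rcases lt_or_ge m 0 with h | h
    · rw [rwStep_eq_zero_of_lt (by push_cast; omega), rwStep_eq_zero_of_lt (by omega),
        rwStep_eq_zero_of_lt (by omega)]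
      simp
    · lift m to ℕ using h
      have e₁ : l = 2 * (m : ℤ) - (n + 1 : ℕ) := by push_cast; omega
      have e₂ : l + 1 = 2 * (m : ℤ) - n := by omega
      rw [e₂, rwStep_two_mul_sub, e₁, rwStep_two_mul_sub]
      cases m with
      | zero =>
        rw [rwStep_eq_zero_of_lt (by push_cast; omega)]
        simp [pow_succ]
        ring
      | succ k =>
        have e₃ : 2 * ((k + 1 : ℕ) : ℤ) - (n + 1 : ℕ) - 1 = 2 * (k : ℤ) - n := by
          push_cast; ring
        rw [e₃, rwStep_two_mul_sub, Nat.choose_succ_succ]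
        push_cast
        ring
  · rw [rwStep_eq_zero_of_odd (by push_cast; omega), rwStep_eq_zero_of_odd (by omega),
      rwStep_eq_zero_of_odd (by omega)]
    simp

theorem integral_cos_int_mul (l : ℤ) :
    ∫ θ in (0 : ℝ)..Real.pi, Real.cos (l * θ) = if l = 0 then Real.pi else 0 := by
  split_ifs with h
  · simp [h]
  · rw [intervalIntegral.integral_comp_mul_left _ (by exact_mod_cast h : (l : ℝ) ≠ 0)]
    simp [Real.sin_int_mul_pi]

/-- The Fourier representation of the simple random walk distribution. -/
theorem integral_cos_pow_mul_cos (n : ℕ) (l : ℤ) :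
    ∫ θ in (0 : ℝ)..Real.pi, Real.cos θ ^ n * Real.cos (l * θ) = Real.pi * rwStep n l := by
  induction n generalizing l with
  | zero => simp [integral_cos_int_mul, rwStep_zero]
  | succ n ih =>
    have key : ∀ θ : ℝ, Real.cos θ ^ (n + 1) * Real.cos (l * θ) =
        (Real.cos θ ^ n * Real.cos ((l - 1 : ℤ) * θ) +
          Real.cos θ ^ n * Real.cos ((l + 1 : ℤ) * θ)) / 2 := by
      intro θ
      push_cast
      rw [sub_mul, add_mul, one_mul, Real.cos_sub, Real.cos_add]
      ring
    simp_rw [key]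
    rw [intervalIntegral.integral_div, intervalIntegral.integral_add, ih, ih, rwStep_succ]
    · ring
    · exact Continuous.intervalIntegrable (by fun_prop) _ _
    · exact Continuous.intervalIntegrable (by fun_prop) _ _

/-- The Fourier representation of the discrete heat kernel. -/
theorem heatKernelZ_eq_integral (c t : ℝ) (l : ℤ) :
    heatKernelZ c t l = Real.pi⁻¹ *
      ∫ θ in (0 : ℝ)..Real.pi, Real.exp (-(2 * c * t) * (1 - Real.cos θ)) * Real.cos (l * θ) := by
  unfold heatKernelZ
  generalize 2 * c * t = s
  have hexp : ∀ x : ℝ, HasSum (fun n : ℕ => x ^ n / (n.factorial : ℝ)) (Real.exp x) := fun x => by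
    rw [Real.exp_eq_exp_ℝ]
    exact NormedSpace.expSeries_div_hasSum_exp x
  have hsum : HasSum
      (fun n : ℕ => ∫ θ in (0 : ℝ)..Real.pi,
        (s * Real.cos θ) ^ n / (n.factorial : ℝ) * Real.cos (l * θ))
      (∫ θ in (0 : ℝ)..Real.pi, Real.exp (s * Real.cos θ) * Real.cos (l * θ)) := by
    refine intervalIntegral.hasSum_integral_of_dominated_convergence
      (fun n _ => |s| ^ n / (n.factorial : ℝ)) (fun n => ?_) (fun n => ?_) ?_ ?_ ?_
    · exact Continuous.aestronglyMeasurable (by fun_prop)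
    · refine Filter.Eventually.of_forall fun θ _ => ?_
      rw [norm_mul, norm_div, norm_pow, norm_mul, Real.norm_natCast]
      simp only [Real.norm_eq_abs]
      calc (|s| * |Real.cos θ|) ^ n / (n.factorial : ℝ) * |Real.cos (l * θ)|
          ≤ (|s| * 1) ^ n / (n.factorial : ℝ) * 1 := by
            gcongr
            · exact Real.abs_cos_le_one _
            · exact Real.abs_cos_le_one _
        _ = |s| ^ n / (n.factorial : ℝ) := by ring
    · exact Filter.Eventually.of_forall fun θ _ => (hexp |s|).summable
    · exact intervalIntegrable_const
    · exact Filter.Eventually.of_forall fun θ _ => (hexp _).mul_right _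
  have hterm : ∀ n : ℕ, ∫ θ in (0 : ℝ)..Real.pi,
        (s * Real.cos θ) ^ n / (n.factorial : ℝ) * Real.cos (l * θ) =
      Real.pi * (s ^ n / (n.factorial : ℝ) * rwStep n l) := by
    intro n
    rw [mul_left_comm, ← integral_cos_pow_mul_cos, ← intervalIntegral.integral_const_mul]
    congr 1
    ext θ
    ring
  simp_rw [hterm] at hsum
  have hfactor : ∀ θ : ℝ, Real.exp (-s * (1 - Real.cos θ)) * Real.cos (l * θ) =
      Real.exp (-s) * (Real.exp (s * Real.cos θ) * Real.cos (l * θ)) := by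
    intro θ
    rw [← mul_assoc, ← Real.exp_add]
    ring_nf
  simp_rw [hfactor]
  rw [intervalIntegral.integral_const_mul, ← hsum.tsum_eq, tsum_mul_left]
  field_simp

theorem integral_mul_exp_neg_mul_sq_le {a : ℝ} (ha : 0 < a) (b : ℝ) :
    ∫ θ in (0 : ℝ)..b, θ * Real.exp (-a * θ ^ 2) ≤ 1 / (2 * a) := by
  have hderiv : ∀ θ : ℝ, HasDerivAt (fun θ : ℝ => -(1 / (2 * a)) * Real.exp (-a * θ ^ 2))
      (θ * Real.exp (-a * θ ^ 2)) θ := by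
    intro θ
    have h := (((hasDerivAt_pow 2 θ).const_mul (-a)).exp).const_mul (-(1 / (2 * a)))
    refine h.congr_deriv ?_
    norm_num
    field_simp
  rw [intervalIntegral.integral_eq_sub_of_hasDerivAt (fun θ _ => hderiv θ)
    (Continuous.intervalIntegrable (by fun_prop) _ _)]
  have : 0 ≤ 1 / (2 * a) * Real.exp (-a * b ^ 2) := by positivity
  simp at this ⊢
  linarith

theorem abs_heatKernelZ_grad_le_integral (c t : ℝ) (l : ℤ) :
    |heatKernelZ c t (l + 1) - heatKernelZ c t l| ≤ Real.pi⁻¹ *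
      ∫ θ in (0 : ℝ)..Real.pi, θ * Real.exp (-(2 * c * t) * (1 - Real.cos θ)) := by
  have hcos_int : ∀ m : ℤ, IntervalIntegrable
      (fun θ => Real.exp (-(2 * c * t) * (1 - Real.cos θ)) * Real.cos (m * θ)) MeasureTheory.volume
      0 Real.pi := fun m => Continuous.intervalIntegrable (by fun_prop) _ _
  rw [heatKernelZ_eq_integral, heatKernelZ_eq_integral, ← mul_sub,
    ← intervalIntegral.integral_sub (hcos_int _) (hcos_int _), abs_mul,
    abs_of_pos (inv_pos.mpr Real.pi_pos)]
  gcongr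
  have hbound : IntervalIntegrable (fun θ => θ * Real.exp (-(2 * c * t) * (1 - Real.cos θ)))
      MeasureTheory.volume 0 Real.pi := Continuous.intervalIntegrable (by fun_prop) _ _
  rw [← Real.norm_eq_abs]
  refine intervalIntegral.norm_integral_le_of_norm_le Real.pi_pos.le
    (Filter.Eventually.of_forall fun θ hθ => ?_) hbound
  rw [← mul_sub, norm_mul, Real.norm_eq_abs, Real.abs_exp, mul_comm, Real.norm_eq_abs]
  gcongr
  have h := Real.abs_cos_sub_cos_le ((l + 1 : ℤ) * θ) (l * θ)
  refine h.trans_eq ?_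
  push_cast
  rw [add_mul, one_mul, add_sub_cancel_left, abs_of_pos hθ.1]

/-- Pointwise gradient decay of the discrete heat kernel on `ℤ`:
`|∇p̄_t(ℓ)| ≤ C·min(1, 1/(ct))` for a universal constant `C > 0`. -/
theorem heatKernelZ_grad_pointwise :
    ∃ C : ℝ, 0 < C ∧ ∀ c t : ℝ, 0 < c → 0 < t → ∀ l : ℤ,
      |heatKernelZ c t (l + 1) - heatKernelZ c t l| ≤ C * min 1 (1 / (c * t)) := by
  refine ⟨2, two_pos, fun c t hc ht l => (abs_heatKernelZ_grad_le_integral c t l).trans ?_⟩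
  have hπ := Real.pi_pos
  have hπ4 := Real.pi_le_four
  rw [mul_min_of_nonneg _ _ zero_le_two]
  refine le_min ?_ ?_
  · have h : ∫ θ in (0 : ℝ)..Real.pi, θ * Real.exp (-(2 * c * t) * (1 - Real.cos θ)) ≤
        ∫ θ in (0 : ℝ)..Real.pi, θ := by
      refine intervalIntegral.integral_mono_on hπ.le
        (Continuous.intervalIntegrable (by fun_prop) _ _)
        (Continuous.intervalIntegrable (by fun_prop) _ _) fun θ hθ => ?_
      refine mul_le_of_le_one_right hθ.1 (Real.exp_le_one_iff.mpr ?_)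
      rw [neg_mul, neg_nonpos]
      exact mul_nonneg (by positivity) (sub_nonneg.mpr (Real.cos_le_one θ))
    rw [integral_id] at h
    rw [inv_mul_le_iff₀ hπ]
    nlinarith
  · have h : ∫ θ in (0 : ℝ)..Real.pi, θ * Real.exp (-(2 * c * t) * (1 - Real.cos θ)) ≤
        ∫ θ in (0 : ℝ)..Real.pi, θ * Real.exp (-(4 * c * t / Real.pi ^ 2) * θ ^ 2) := by
      refine intervalIntegral.integral_mono_on hπ.le
        (Continuous.intervalIntegrable (by fun_prop) _ _)
        (Continuous.intervalIntegrable (by fun_prop) _ _) fun θ hθ => ?_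
      refine mul_le_mul_of_nonneg_left (Real.exp_le_exp.mpr ?_) hθ.1
      have hcos := Real.cos_le_one_sub_mul_cos_sq (abs_le.mpr ⟨by linarith [hθ.1], hθ.2⟩)
      calc -(2 * c * t) * (1 - Real.cos θ)
          ≤ -(2 * c * t) * (2 / Real.pi ^ 2 * θ ^ 2) :=
            mul_le_mul_of_nonpos_left (by linarith) (neg_nonpos.mpr (by positivity))
        _ = -(4 * c * t / Real.pi ^ 2) * θ ^ 2 := by ring
    have h' := h.trans (integral_mul_exp_neg_mul_sq_le (by positivity) _)
    rw [inv_mul_le_iff₀ hπ]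
    refine h'.trans ?_
    have e : 1 / (2 * (4 * c * t / Real.pi ^ 2)) = Real.pi * (Real.pi / 8) * (1 / (c * t)) := by
      field_simp
      norm_num
    rw [e, mul_assoc]
    gcongr
    linarith
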